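/- arXiv:1006.0326 — 3 statements merged into one kernel-verified Lean document; each statement's English description precedes it below -/
import Mathlib

section
/- For bounded operators A, B, C on a Hilbert space with A, B selfadjoint and dist(spect(A), spect(B)) = d > 0, there exists a bounded operator X solving AX − XB = C with ‖X‖ ≤ (π/2)‖C‖/d. -/
open Real

open MeasureTheory Filter Topology

/-- A compact metric space carries continuous partitions of unity, with values in `ℂ`, of
arbitrarily small mesh. -/
lemma exists_partition_of_mesh_lt {K : Type*} [MetricSpace K] [CompactSpace K] {ε : ℝ}
    (hε : 0 < ε) :
    ∃ (s : Finset K) (φ : K → C(K, ℂ)), (∑ j ∈ s, φ j = 1) ∧ (∀ x, ∑ j ∈ s, ‖φ j x‖ = 1) ∧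
      ∀ j ∈ s, ∀ x, φ j x ≠ 0 → dist x j < ε := by
  classical
  obtain ⟨s, hs⟩ := CompactSpace.elim_nhds_subcover (fun x : K => Metric.ball x ε)
    (fun x => Metric.ball_mem_nhds x hε)
  obtain ⟨f, hf⟩ := PartitionOfUnity.exists_isSubordinate (s := (Set.univ : Set K)) isClosed_univ
    (fun j : s => Metric.ball (j : K) ε) (fun _ => Metric.isOpen_ball) (by
      intro x _
      have hx : x ∈ ⋃ y ∈ s, Metric.ball y ε := by rw [hs]; trivial
      simpa using hx)
  have hsum (x : K) : ∑ j : s, f j x = 1 := by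
    rw [← finsum_eq_sum_of_fintype]
    exact f.sum_eq_one (Set.mem_univ x)
  let φ : K → C(K, ℂ) := fun j =>
    if h : j ∈ s then ⟨fun x => (f ⟨j, h⟩ x : ℂ), by fun_prop⟩ else 0
  have hφ (j : s) (x : K) : φ j x = (f j x : ℂ) := by simp [φ]
  refine ⟨s, φ, ?_, fun x => ?_, fun j hj x hx => ?_⟩
  · ext x
    rw [← Finset.sum_coe_sort, ContinuousMap.sum_apply]
    simp only [hφ]
    rw [← Complex.ofReal_sum, hsum]
    simp
  · rw [← Finset.sum_coe_sort, ← hsum x]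
    refine Finset.sum_congr rfl fun j _ => ?_
    rw [hφ, Complex.norm_real, Real.norm_of_nonneg (f.nonneg j x)]
  · rw [hφ ⟨j, hj⟩] at hx
    exact hf ⟨j, hj⟩ (subset_tsupport _ (by simpa using hx))

/-- Finite rank interpolation operators on `C(K, ℂ)` converging strongly to the identity. -/
lemma exists_seq_interpolation (K : Type*) [MetricSpace K] [CompactSpace K] :
    ∃ (s : ℕ → Finset K) (φ : ℕ → K → C(K, ℂ)), (∀ n, ∑ j ∈ s n, φ n j = 1) ∧
      (∀ n (g : C(K, ℂ)), ‖∑ j ∈ s n, g j • φ n j‖ ≤ ‖g‖) ∧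
      ∀ g : C(K, ℂ), Tendsto (fun n => ∑ j ∈ s n, g j • φ n j) atTop (𝓝 g) := by
  choose s φ h1 h2 h3 using fun n : ℕ =>
    exists_partition_of_mesh_lt (K := K) (ε := 1 / ((n : ℝ) + 1)) (by positivity)
  refine ⟨s, φ, h1, fun n g => ?_, fun g => ?_⟩
  · rw [ContinuousMap.norm_le _ (norm_nonneg g)]
    intro x
    rw [ContinuousMap.sum_apply]
    calc ‖∑ j ∈ s n, (g j • φ n j) x‖ ≤ ∑ j ∈ s n, ‖g‖ * ‖φ n j x‖ := by
          refine norm_sum_le_of_le _ fun j _ => ?_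
          rw [ContinuousMap.smul_apply, norm_smul]
          gcongr
          exact g.norm_coe_le_norm j
      _ = ‖g‖ := by rw [← Finset.mul_sum, h2, mul_one]
  · rw [Metric.tendsto_atTop]
    intro ε hε
    obtain ⟨δ, hδ, hg⟩ := Metric.uniformContinuous_iff.1
      (CompactSpace.uniformContinuous_of_continuous g.continuous) (ε / 2) (by positivity)
    obtain ⟨N, hN⟩ := exists_nat_one_div_lt hδ
    refine ⟨N, fun n hn => ?_⟩
    have hnδ : 1 / ((n : ℝ) + 1) < δ := lt_of_le_of_lt (by gcongr) hN
    rw [dist_eq_norm]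
    refine lt_of_le_of_lt ?_ (half_lt_self hε)
    rw [ContinuousMap.norm_le _ (by positivity)]
    intro x
    have hx : g x = ∑ j ∈ s n, g x * φ n j x := by
      rw [← Finset.mul_sum, ← ContinuousMap.sum_apply, h1]
      simp
    rw [ContinuousMap.sub_apply, ContinuousMap.sum_apply, hx, ← Finset.sum_sub_distrib]
    calc ‖∑ j ∈ s n, ((g j • φ n j) x - g x * φ n j x)‖
        ≤ ∑ j ∈ s n, ε / 2 * ‖φ n j x‖ := by
          refine norm_sum_le_of_le _ fun j hj => ?_
          rw [ContinuousMap.smul_apply, smul_eq_mul, ← sub_mul, norm_mul]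
          by_cases h0 : φ n j x = 0
          · simp [h0]
          · gcongr
            rw [← dist_eq_norm]
            refine (hg ?_).le
            rw [dist_comm]
            exact (h3 n j hj x h0).trans hnδ
      _ = ε / 2 := by rw [← Finset.mul_sum, h2, mul_one]

lemma tendsto_sum_interpolation {Ω K F E : Type*} [MeasurableSpace Ω] {μ : Measure Ω}
    [MetricSpace K] [CompactSpace K]
    [NormedAddCommGroup F] [NormedSpace ℂ F] [CompleteSpace F]
    [NormedAddCommGroup E] [NormedSpace ℂ E] [CompleteSpace E]
    {s : ℕ → Finset K} {φ : ℕ → K → C(K, ℂ)}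
    (hle : ∀ n (g : C(K, ℂ)), ‖∑ j ∈ s n, g j • φ n j‖ ≤ ‖g‖)
    (hlim : ∀ g : C(K, ℂ), Tendsto (fun n => ∑ j ∈ s n, g j • φ n j) atTop (𝓝 g))
    (T : C(K, ℂ) →L[ℂ] F →L[ℂ] E) {G : Ω → C(K, ℂ)} (hG : Integrable G μ)
    {c : Ω → F} (hc : AEStronglyMeasurable c μ) {M : ℝ} (hM : ∀ ω, ‖c ω‖ ≤ M) :
    Tendsto (fun n => ∑ j ∈ s n, T (φ n j) (∫ ω, G ω j • c ω ∂μ)) atTop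
      (𝓝 (∫ ω, T (G ω) (c ω) ∂μ)) := by
  have hint (j : K) : Integrable (fun ω => G ω j • c ω) μ :=
    ((ContinuousMap.evalCLM ℂ j).integrable_comp hG).smul_bdd M hc (ae_of_all _ hM)
  have hterm (n : ℕ) (ω : Ω) : T (∑ j ∈ s n, G ω j • φ n j) (c ω) =
      ∑ j ∈ s n, T (φ n j) (G ω j • c ω) := by
    simp [map_sum]
  have heq (n : ℕ) : ∑ j ∈ s n, T (φ n j) (∫ ω, G ω j • c ω ∂μ) =
      ∫ ω, T (∑ j ∈ s n, G ω j • φ n j) (c ω) ∂μ := by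
    simp_rw [hterm]
    rw [integral_finsetSum _ fun j _ => (T (φ n j)).integrable_comp (hint j)]
    exact Finset.sum_congr rfl fun j _ => ((T (φ n j)).integral_comp_comm (hint j)).symm
  simp_rw [heq]
  refine tendsto_integral_of_dominated_convergence (fun ω => ‖T‖ * ‖G ω‖ * M) (fun n => ?_)
    ((hG.norm.const_mul _).mul_const _) (fun n => ae_of_all _ fun ω => ?_)
    (ae_of_all _ fun ω => ?_)
  · simp_rw [hterm]
    exact (integrable_finsetSum _ fun j _ =>
      (T (φ n j)).integrable_comp (hint j)).aestronglyMeasurable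
  · calc _ ≤ ‖T‖ * ‖∑ j ∈ s n, G ω j • φ n j‖ * ‖c ω‖ := T.le_opNorm₂ _ _
      _ ≤ _ := by
        gcongr
        · exact hle n _
        · exact hM ω
  · exact ((T.flip (c ω)).continuous.tendsto _).comp (hlim (G ω))

/-- The character `x ↦ exp (i t x)` restricted to a set `S ⊆ ℂ`. -/
noncomputable def expChar (S : Set ℂ) (t : ℝ) : C(S, ℂ) :=
  ⟨fun x => Complex.exp (Complex.I * t * x), by fun_prop⟩

lemma continuous_expChar (S : Set ℂ) : Continuous (expChar S) := by
  refine ContinuousMap.continuous_of_continuous_uncurry _ ?_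
  simp only [Function.uncurry_def, expChar, ContinuousMap.coe_mk]
  fun_prop

lemma norm_expChar_le {S : Set ℂ} [CompactSpace S] (hS : ∀ x ∈ S, x.im = 0) (t : ℝ) :
    ‖expChar S t‖ ≤ 1 := by
  rw [ContinuousMap.norm_le _ zero_le_one]
  intro x
  simp [expChar, Complex.norm_exp, hS x x.2]

/-- If the measure `w μ` pushed forward along `τ` has Fourier transform `1 / s` at all differences
`s` of the spectra, then it solves the Sylvester equation. -/
theorem exists_sylvester_of_kernel {E : Type*} [CStarAlgebra E] {A B : E} (C : E)
    (hA : IsSelfAdjoint A) (hB : IsSelfAdjoint B) {Ω : Type*} [MeasurableSpace Ω]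
    {μ : Measure Ω} {w : Ω → ℂ} (hw : Integrable w μ) {τ : Ω → ℝ} (hτ : Measurable τ)
    (hne : ∀ a ∈ spectrum ℂ A, ∀ b ∈ spectrum ℂ B, a - b ≠ 0)
    (hker : ∀ a ∈ spectrum ℂ A, ∀ b ∈ spectrum ℂ B,
      ∫ ω, w ω * Complex.exp (Complex.I * τ ω * (a - b)) ∂μ = (a - b)⁻¹) :
    ∃ X : E, A * X - X * B = C ∧ ‖X‖ ≤ (∫ ω, ‖w ω‖ ∂μ) * ‖C‖ := by
  set SA := spectrum ℂ A
  set SB := spectrum ℂ B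
  have hAim : ∀ x ∈ SA, x.im = 0 := fun x hx => hA.im_eq_zero_of_mem_spectrum hx
  have hBim : ∀ x ∈ SB, x.im = 0 := fun x hx => hB.im_eq_zero_of_mem_spectrum hx
  let cA : C(SA, ℂ) →L[ℂ] E :=
    ⟨(cfcHom hA.isStarNormal : C(SA, ℂ) →⋆ₐ[ℂ] E).toAlgHom.toLinearMap,
      cfcHom_continuous hA.isStarNormal⟩
  let cB : C(SB, ℂ) →L[ℂ] E :=
    ⟨(cfcHom hB.isStarNormal : C(SB, ℂ) →⋆ₐ[ℂ] E).toAlgHom.toLinearMap,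
      cfcHom_continuous hB.isStarNormal⟩
  have cA_mul (f g) : cA (f * g) = cA f * cA g := map_mul (cfcHom hA.isStarNormal) f g
  have cB_mul (f g) : cB (f * g) = cB f * cB g := map_mul (cfcHom hB.isStarNormal) f g
  have cA_one : cA 1 = 1 := map_one (cfcHom hA.isStarNormal)
  have cB_one : cB 1 = 1 := map_one (cfcHom hB.isStarNormal)
  have cA_norm (f) : ‖cA f‖ = ‖f‖ := norm_cfcHom A f hA.isStarNormal
  have cB_norm (f) : ‖cB f‖ = ‖f‖ := norm_cfcHom B f hB.isStarNormal
  let idA : C(SA, ℂ) := (ContinuousMap.id ℂ).restrict SA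
  let idB : C(SB, ℂ) := (ContinuousMap.id ℂ).restrict SB
  have cA_id : cA idA = A := cfcHom_id hA.isStarNormal
  have cB_id : cB idB = B := cfcHom_id hB.isStarNormal
  let T : C(SA, ℂ) →L[ℂ] E →L[ℂ] E :=
    (ContinuousLinearMap.mul ℂ E).comp (((ContinuousLinearMap.mul ℂ E).flip C).comp cA)
  have hT (f Y) : T f Y = cA f * C * Y := rfl
  let eA : Ω → C(SA, ℂ) := fun ω => expChar SA (τ ω)
  let eB : Ω → C(SB, ℂ) := fun ω => expChar SB (-τ ω)
  have eA_meas : AEStronglyMeasurable eA μ :=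
    ((continuous_expChar SA).stronglyMeasurable.comp_measurable hτ).aestronglyMeasurable
  have eB_meas : AEStronglyMeasurable eB μ :=
    ((continuous_expChar SB).stronglyMeasurable.comp_measurable hτ.neg).aestronglyMeasurable
  have eA_norm (ω) : ‖eA ω‖ ≤ 1 := norm_expChar_le hAim _
  have eB_norm (ω) : ‖eB ω‖ ≤ 1 := norm_expChar_le hBim _
  let c : Ω → E := fun ω => cB (eB ω)
  have c_meas : AEStronglyMeasurable c μ := cB.continuous.comp_aestronglyMeasurable eB_meas
  have c_norm (ω) : ‖c ω‖ ≤ 1 := (cB_norm _).trans_le (eB_norm ω)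
  have hG : Integrable (fun ω => w ω • eA ω) μ :=
    hw.smul_bdd 1 eA_meas (ae_of_all _ eA_norm)
  have hG' : Integrable (fun ω => idA * (w ω • eA ω)) μ := hG.const_mul idA
  have c'_meas : AEStronglyMeasurable (fun ω => c ω * B) μ := c_meas.mul_const B
  have c'_norm (ω) : ‖c ω * B‖ ≤ ‖B‖ := (norm_mul_le _ _).trans
    ((mul_le_mul_of_nonneg_right (c_norm ω) (norm_nonneg _)).trans_eq (one_mul _))
  have hint : Integrable (fun ω => T (w ω • eA ω) (c ω)) μ := by
    have h := (T.integrable_comp hG).norm.const_mul 1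
    refine Integrable.mono' h ?_ (ae_of_all _ fun ω => ?_)
    · exact isBoundedBilinearMap_apply.continuous.comp_aestronglyMeasurable
        ((T.integrable_comp hG).aestronglyMeasurable.prodMk c_meas)
    · rw [one_mul]
      exact ((T (w ω • eA ω)).le_opNorm _).trans
        (mul_le_of_le_one_right (norm_nonneg _) (c_norm ω))
  have hBint (a : ℂ) (ha : a ∈ SA) :
      Integrable (fun ω => (w ω * Complex.exp (Complex.I * τ ω * a)) • eB ω) μ := by
    have := ((ContinuousMap.evalCLM ℂ (⟨a, ha⟩ : SA)).integrable_comp hG).smul_bdd 1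
      eB_meas (ae_of_all _ eB_norm)
    exact this
  have key (a : SA) : ∫ ω, (idA * (w ω • eA ω)) a • c ω ∂μ -
      ∫ ω, (w ω • eA ω) a • (c ω * B) ∂μ = 1 := by
    set R : C(SB, ℂ) := ∫ ω, (w ω * Complex.exp (Complex.I * τ ω * a)) • eB ω ∂μ with hR
    have hcR : ∫ ω, (w ω • eA ω) a • c ω ∂μ = cB R := by
      rw [hR, ← cB.integral_comp_comm (hBint a a.2)]
      refine integral_congr_ae (ae_of_all _ fun ω => ?_)
      simp only [map_smul]
      rfl
    have hcint : Integrable (fun ω => (w ω • eA ω) a • c ω) μ := by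
      have := cB.integrable_comp (hBint a a.2)
      simp only [map_smul] at this
      exact this
    have h1 : ∫ ω, (idA * (w ω • eA ω)) a • c ω ∂μ = (a : ℂ) • cB R := by
      rw [← hcR, ← integral_smul]
      refine integral_congr_ae (ae_of_all _ fun ω => ?_)
      simp only [ContinuousMap.mul_apply, smul_smul]
      rfl
    have h2 : ∫ ω, (w ω • eA ω) a • (c ω * B) ∂μ = cB (R * idB) := by
      rw [cB_mul, cB_id, ← hcR, ← integral_mul_const_of_integrable hcint]
      refine integral_congr_ae (ae_of_all _ fun ω => ?_)
      simp only [smul_mul_assoc]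
    rw [h1, h2, ← map_smul, ← map_sub, ← cB_one]
    congr 1
    ext b
    have hRb : R b = ((a : ℂ) - b)⁻¹ := by
      rw [hR, ContinuousMap.integral_apply (hBint a a.2), ← hker a a.2 b b.2]
      refine integral_congr_ae (ae_of_all _ fun ω => ?_)
      simp only [ContinuousMap.smul_apply, smul_eq_mul, mul_assoc, eB, expChar,
        ContinuousMap.coe_mk, ← Complex.exp_add]
      congr 2
      push_cast
      ring
    have hidb : idB b = (b : ℂ) := rfl
    simp only [ContinuousMap.sub_apply, ContinuousMap.smul_apply, ContinuousMap.mul_apply, hRb,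
      hidb, smul_eq_mul, ContinuousMap.one_apply]
    have := hne a a.2 b b.2
    field_simp
  refine ⟨∫ ω, T (w ω • eA ω) (c ω) ∂μ, ?_, ?_⟩
  · obtain ⟨s, φ, h1, h2, h3⟩ := exists_seq_interpolation SA
    have hlim := (tendsto_sum_interpolation h2 h3 T hG' c_meas c_norm).sub
      (tendsto_sum_interpolation h2 h3 T hG c'_meas c'_norm)
    rw [← integral_const_mul_of_integrable hint, ← integral_mul_const_of_integrable hint]
    have e1 : ∀ ω, A * T (w ω • eA ω) (c ω) = T (idA * (w ω • eA ω)) (c ω) := fun ω => by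
      simp only [hT, cA_mul, cA_id, mul_assoc]
    have e2 : ∀ ω, T (w ω • eA ω) (c ω) * B = T (w ω • eA ω) (c ω * B) := fun ω => by
      simp only [hT, mul_assoc]
    simp_rw [e1, e2]
    refine tendsto_nhds_unique hlim ?_
    refine tendsto_const_nhds.congr fun n => ?_
    rw [← Finset.sum_sub_distrib]
    have e3 : ∀ j ∈ s n, T (φ n j) (∫ ω, (idA * (w ω • eA ω)) j • c ω ∂μ) -
        T (φ n j) (∫ ω, (w ω • eA ω) j • (c ω * B) ∂μ) = cA (φ n j) * C := fun j _ => by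
      rw [← map_sub, key, hT, mul_one]
    rw [Finset.sum_congr rfl e3, ← Finset.sum_mul, ← map_sum, h1, cA_one, one_mul]
  · rw [← integral_mul_const]
    refine norm_integral_le_of_norm_le (hw.norm.mul_const _) (ae_of_all _ fun ω => ?_)
    rw [hT]
    calc ‖cA (w ω • eA ω) * C * c ω‖ ≤ ‖cA (w ω • eA ω)‖ * ‖C‖ * ‖c ω‖ := norm_mul₃_le
      _ ≤ (‖w ω‖ * 1) * ‖C‖ * 1 := by
        gcongr
        · rw [cA_norm, norm_smul]
          gcongr
          exact eA_norm ω
        · exact c_norm ω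
      _ = ‖w ω‖ * ‖C‖ := by ring

lemma hasSum_coth {x : ℝ} (hx : 0 < x) :
    HasSum (fun n : ℕ => 2 * x / (x ^ 2 + ((n : ℝ) + 1) ^ 2))
      (π * (cosh (π * x) / sinh (π * x)) - 1 / x) := by
  have hz : (x : ℂ) * Complex.I ∈ Complex.integerComplement := by
    rintro ⟨n, hn⟩
    have := congrArg Complex.im hn
    simp at this
    exact hx.ne this
  have h : HasSum (fun n : ℕ => 1 / ((x : ℂ) * Complex.I - (n + 1)) +
      1 / ((x : ℂ) * Complex.I + (n + 1)))
      (π * Complex.cot (π * (x * Complex.I)) - 1 / (x * Complex.I)) := by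
    rw [cot_series_rep' hz]
    exact (summable_cotTerm hz).hasSum
  have hs : Complex.sinh (π * x) ≠ 0 := by
    rw [← Complex.ofReal_mul, ← Complex.ofReal_sinh]
    exact_mod_cast (sinh_pos_iff.2 (by positivity : 0 < π * x)).ne'
  have hx' : (x : ℂ) ≠ 0 := by exact_mod_cast hx.ne'
  rw [← Complex.hasSum_ofReal]
  have hterm : (fun n : ℕ => ((2 * x / (x ^ 2 + ((n : ℝ) + 1) ^ 2) : ℝ) : ℂ)) =
      fun n : ℕ => Complex.I * (1 / ((x : ℂ) * Complex.I - (n + 1)) +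
        1 / ((x : ℂ) * Complex.I + (n + 1))) := by
    funext n
    have hp : ((x : ℂ) ^ 2 + ((n : ℂ) + 1) ^ 2) ≠ 0 := by
      norm_cast
      positivity
    have hmul : ((x : ℂ) * Complex.I - (n + 1)) * ((x : ℂ) * Complex.I + (n + 1)) =
        -((x : ℂ) ^ 2 + ((n : ℂ) + 1) ^ 2) := by
      linear_combination (x : ℂ) ^ 2 * Complex.I_sq
    have h0 := mul_ne_zero_iff.1 (hmul ▸ neg_ne_zero.2 hp)
    rw [div_add_div _ _ h0.1 h0.2, hmul]
    push_cast
    field_simp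
    linear_combination (2 * x : ℂ) * Complex.I_sq
  have hval : ((π * (cosh (π * x) / sinh (π * x)) - 1 / x : ℝ) : ℂ) =
      Complex.I * (π * Complex.cot (π * (x * Complex.I)) - 1 / (x * Complex.I)) := by
    rw [Complex.cot_eq_cos_div_sin, ← mul_assoc, Complex.cos_mul_I, Complex.sin_mul_I]
    push_cast
    field_simp
  rw [hterm, hval]
  exact h.mul_left Complex.I

lemma hasSum_tanh {x : ℝ} (hx : 0 < x) :
    HasSum (fun k : ℕ => 2 * x / (x ^ 2 + (2 * (k : ℝ) + 1) ^ 2)) (π / 2 * tanh (π * x / 2)) := by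
  have h1 := hasSum_coth hx
  have h2 := (hasSum_coth (half_pos hx)).mul_left (1 / 2)
  have hev : Summable (fun k : ℕ => 2 * x / (x ^ 2 + (((2 * k : ℕ) : ℝ) + 1) ^ 2)) :=
    h1.summable.comp_injective (i := fun k : ℕ => 2 * k) fun a b h => by simpa using h
  have hodd : HasSum (fun k : ℕ => 2 * x / (x ^ 2 + (((2 * k + 1 : ℕ) : ℝ) + 1) ^ 2))
      (1 / 2 * (π * (cosh (π * (x / 2)) / sinh (π * (x / 2))) - 1 / (x / 2))) := by
    refine h2.congr_fun fun k => ?_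
    push_cast
    have : (0 : ℝ) < (k : ℝ) + 1 := by positivity
    field_simp
    ring
  have heq := h1.unique (hev.hasSum.even_add_odd hodd)
  have hev' := hev.hasSum
  rw [eq_sub_iff_add_eq.2 heq.symm] at hev'
  convert hev' using 1
  · simp
  · have hs : 0 < sinh (π * (x / 2)) := sinh_pos_iff.2 (by positivity)
    have hc : 0 < cosh (π * (x / 2)) := cosh_pos _
    rw [show π * x = 2 * (π * (x / 2)) by ring, cosh_two_mul, sinh_two_mul,
      show 2 * (π * (x / 2)) / 2 = π * (x / 2) by ring, tanh_eq_sinh_div_cosh]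
    field_simp
    ring

lemma hasSum_telescope {u : ℝ} (hu : 0 ≤ u) :
    HasSum (fun k : ℕ => 1 / (2 * (k : ℝ) + 1 + u) - 1 / (2 * (k : ℝ) + 1 + (u + 2)))
      (1 / (1 + u)) := by
  rw [hasSum_iff_tendsto_nat_of_nonneg]
  · have h (n : ℕ) : ∑ k ∈ Finset.range n,
        (1 / (2 * (k : ℝ) + 1 + u) - 1 / (2 * (k : ℝ) + 1 + (u + 2))) =
        1 / (1 + u) - 1 / (2 * (n : ℝ) + (1 + u)) := by
      induction n with
      | zero => simp
      | succ n ih =>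
        rw [Finset.sum_range_succ, ih]
        push_cast
        ring
    simp_rw [h]
    have ht : Tendsto (fun n : ℕ => 2 * (n : ℝ) + (1 + u)) atTop atTop :=
      tendsto_atTop_add_const_right _ _
        (tendsto_natCast_atTop_atTop.const_mul_atTop (by norm_num))
    simpa using (tendsto_const_nhds (x := 1 / (1 + u))).sub (ht.inv_tendsto_atTop)
  · intro k
    rw [sub_nonneg]
    gcongr
    linarith

lemma integral_sq_div_mul {m u : ℝ} (hm : 0 < m) (hu : 0 ≤ u) :
    IntegrableOn (fun x : ℝ => x ^ 2 / ((x ^ 2 + m ^ 2) * (x ^ 2 + u ^ 2))) (Set.Ioi 0) ∧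
    ∫ x in Set.Ioi (0 : ℝ), x ^ 2 / ((x ^ 2 + m ^ 2) * (x ^ 2 + u ^ 2)) =
      π / (2 * (m + u)) := by
  have hnn : ∀ x ∈ Set.Ioi (0 : ℝ), 0 ≤ x ^ 2 / ((x ^ 2 + m ^ 2) * (x ^ 2 + u ^ 2)) :=
    fun x _ => by positivity
  have harc {k : ℝ} (hk : 0 < k) : Tendsto (fun x : ℝ => arctan (x / k)) atTop (𝓝 (π / 2)) :=
    (tendsto_nhds_of_tendsto_nhdsWithin tendsto_arctan_atTop).comp
      (tendsto_id.atTop_div_const hk)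
  have hder {k : ℝ} (hk : 0 < k) (x : ℝ) :
      HasDerivAt (fun x : ℝ => arctan (x / k)) (k / (x ^ 2 + k ^ 2)) x := by
    refine ((hasDerivAt_id' x).div_const k).arctan.congr_deriv ?_
    field_simp
    ring
  suffices H : ∃ g : ℝ → ℝ, Continuous g ∧ g 0 = 0 ∧
      (∀ x ∈ Set.Ioi (0 : ℝ), HasDerivAt g (x ^ 2 / ((x ^ 2 + m ^ 2) * (x ^ 2 + u ^ 2))) x) ∧
      Tendsto g atTop (𝓝 (π / (2 * (m + u)))) by
    obtain ⟨g, hg, hg0, hg', hlim⟩ := H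
    refine ⟨integrableOn_Ioi_deriv_of_nonneg hg.continuousWithinAt hg' hnn hlim, ?_⟩
    rw [integral_Ioi_of_hasDerivAt_of_nonneg hg.continuousWithinAt hg' hnn hlim, hg0, sub_zero]
  rcases eq_or_ne m u with rfl | hne
  · refine ⟨fun x => arctan (x / m) / (2 * m) - x / (2 * (x ^ 2 + m ^ 2)), ?_, by simp,
      fun x hx => ?_, ?_⟩
    · have h0 (x : ℝ) : 2 * (x ^ 2 + m ^ 2) ≠ 0 := by positivity
      fun_prop (disch := assumption)
    · have h0 : 2 * (x ^ 2 + m ^ 2) ≠ 0 := by positivity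
      refine (((hder hm x).div_const (2 * m)).sub ((hasDerivAt_id' x).fun_div
        ((((hasDerivAt_id' x).fun_pow 2).add_const (m ^ 2)).const_mul 2) h0)).congr_deriv ?_
      push_cast
      field_simp
      ring
    · have h2 : Tendsto (fun x : ℝ => x / (2 * (x ^ 2 + m ^ 2))) atTop (𝓝 0) := by
        refine squeeze_zero' (Filter.eventually_atTop.2 ⟨1, fun x hx => by positivity⟩)
          (Filter.eventually_atTop.2 ⟨1, fun x hx => ?_⟩) tendsto_inv_atTop_zero
        have : 0 < x := by linarith
        rw [div_le_iff₀ (by positivity)]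
        field_simp
        nlinarith [sq_nonneg m]
      have h := ((harc hm).div_const (2 * m)).sub h2
      rwa [show π / 2 / (2 * m) - 0 = π / (2 * (m + m)) by field_simp; ring] at h
  rcases hu.eq_or_lt with rfl | hu
  · refine ⟨fun x => arctan (x / m) / m, by fun_prop, by simp, fun x hx => ?_, ?_⟩
    · have hx' : x ≠ 0 := ne_of_gt hx
      refine ((hder hm x).div_const m).congr_deriv ?_
      field_simp
      simp
    · have h := (harc hm).div_const m
      rwa [show π / 2 / m = π / (2 * (m + 0)) by field_simp; ring] at h
  · have hmu : m ^ 2 - u ^ 2 ≠ 0 := by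
      rw [sq_sub_sq]
      exact mul_ne_zero (by positivity) (sub_ne_zero.2 hne)
    refine ⟨fun x => (m * arctan (x / m) - u * arctan (x / u)) / (m ^ 2 - u ^ 2), by fun_prop,
      by simp, fun x hx => ?_, ?_⟩
    · refine ((((hder hm x).const_mul m).sub ((hder hu x).const_mul u)).div_const
        (m ^ 2 - u ^ 2)).congr_deriv ?_
      field_simp
      ring
    · have h := (((harc hm).const_mul m).sub ((harc hu).const_mul u)).div_const (m ^ 2 - u ^ 2)
      have hne' := sub_ne_zero.2 hne
      rwa [show (m * (π / 2) - u * (π / 2)) / (m ^ 2 - u ^ 2) = π / (2 * (m + u)) by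
        rw [sq_sub_sq]; field_simp] at h

/-- A Laplace-type integral of `tanh`, evaluated through its partial fraction expansion. -/
lemma integral_tanh_mul {s : ℝ} (hs : 1 ≤ s) :
    ∫ x in Set.Ioi (0 : ℝ), tanh (π * x / 2) *
      (x / (x ^ 2 + (s - 1) ^ 2) - x / (x ^ 2 + (s + 1) ^ 2)) = 2 / s := by
  obtain ⟨u, rfl⟩ : ∃ u, s = 1 + u := ⟨s - 1, by ring⟩
  have hu : 0 ≤ u := by linarith
  rw [show 1 + u - 1 = u by ring, show 1 + u + 1 = u + 2 by ring]
  set g : ℝ → ℝ := fun x => x / (x ^ 2 + u ^ 2) - x / (x ^ 2 + (u + 2) ^ 2) with hg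
  let F : ℕ → ℝ → ℝ := fun k x => 2 * x / (x ^ 2 + (2 * (k : ℝ) + 1) ^ 2) * g x
  have hF (k : ℕ) : F k = fun x =>
      2 * (x ^ 2 / ((x ^ 2 + (2 * (k : ℝ) + 1) ^ 2) * (x ^ 2 + u ^ 2)) -
        x ^ 2 / ((x ^ 2 + (2 * (k : ℝ) + 1) ^ 2) * (x ^ 2 + (u + 2) ^ 2))) := by
    funext x
    simp only [F, hg, mul_sub, div_mul_div_comm]
    ring
  have hk (k : ℕ) : (0 : ℝ) < 2 * (k : ℝ) + 1 := by positivity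
  have hFint (k : ℕ) : IntegrableOn (F k) (Set.Ioi 0) := by
    rw [hF]
    exact ((integral_sq_div_mul (hk k) hu).1.sub
      (integral_sq_div_mul (hk k) (by positivity)).1).const_mul 2
  have hFval (k : ℕ) : ∫ x in Set.Ioi (0 : ℝ), F k x =
      π * (1 / (2 * (k : ℝ) + 1 + u) - 1 / (2 * (k : ℝ) + 1 + (u + 2))) := by
    rw [hF, integral_const_mul, integral_sub (integral_sq_div_mul (hk k) hu).1
      (integral_sq_div_mul (hk k) (by positivity)).1, (integral_sq_div_mul (hk k) hu).2,
      (integral_sq_div_mul (hk k) (by positivity)).2]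
    have := hk k
    field_simp
  have hFnorm (k : ℕ) : ∫ x in Set.Ioi (0 : ℝ), ‖F k x‖ = ∫ x in Set.Ioi (0 : ℝ), F k x := by
    refine setIntegral_congr_fun measurableSet_Ioi fun x (hx : 0 < x) => norm_of_nonneg ?_
    have : 0 ≤ g x := by
      rw [hg, sub_nonneg]
      gcongr
      linarith
    positivity
  have hsum := (hasSum_telescope hu).mul_left π
  have h := hasSum_integral_of_summable_integral_norm hFint
    (by simp_rw [hFnorm, hFval]; exact hsum.summable)
  simp_rw [hFval] at h
  have h' := h.unique hsum
  have ht : ∫ x in Set.Ioi (0 : ℝ), ∑' k, F k x =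
      π / 2 * ∫ x in Set.Ioi (0 : ℝ), tanh (π * x / 2) * g x := by
    rw [← integral_const_mul]
    refine setIntegral_congr_fun measurableSet_Ioi fun x hx => ?_
    simp only [F]
    rw [((hasSum_tanh hx).mul_right (g x)).tsum_eq, mul_assoc]
  rw [ht] at h'
  rw [eq_div_iff (by positivity)]
  have := pi_pos
  field_simp at h'
  exact h'

lemma integral_exp_neg_abs_mul {x : ℝ} (hx : 0 < x) (u : ℝ) :
    Integrable (fun t : ℝ => Complex.exp (-(|t| * x) + Complex.I * u * t)) ∧
    ∫ t : ℝ, Complex.exp (-(|t| * x) + Complex.I * u * t) = 2 * x / (x ^ 2 + u ^ 2) := by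
  have e1 : Set.EqOn (fun t : ℝ => Complex.exp (-(|t| * x) + Complex.I * u * t))
      (fun t : ℝ => Complex.exp ((-x + Complex.I * u) * t)) (Set.Ioi 0) := fun t (ht : 0 < t) => by
    simp only [abs_of_pos ht]
    ring_nf
  have e2 : Set.EqOn (fun t : ℝ => Complex.exp (-(|t| * x) + Complex.I * u * t))
      (fun t : ℝ => Complex.exp ((x + Complex.I * u) * t)) (Set.Iic 0) := fun t (ht : t ≤ 0) => by
    simp only [abs_of_nonpos ht]
    push_cast
    ring_nf
  have r1 : (-x + Complex.I * u : ℂ).re < 0 := by simpa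
  have r2 : 0 < (x + Complex.I * u : ℂ).re := by simpa
  have i1 := (integrableOn_exp_mul_complex_Ioi r1 0).congr_fun e1.symm measurableSet_Ioi
  have i2 := (integrableOn_exp_mul_complex_Iic r2 0).congr_fun e2.symm measurableSet_Iic
  have hi : Integrable (fun t : ℝ => Complex.exp (-(|t| * x) + Complex.I * u * t)) := by
    rw [← integrableOn_univ, ← Set.Iic_union_Ioi (a := (0 : ℝ))]
    exact i2.union i1
  refine ⟨hi, ?_⟩
  rw [← intervalIntegral.integral_Iic_add_Ioi i2 i1, setIntegral_congr_fun measurableSet_Iic e2,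
    setIntegral_congr_fun measurableSet_Ioi e1, integral_exp_mul_complex_Ioi r1,
    integral_exp_mul_complex_Iic r2]
  have n1 : (-x + Complex.I * u : ℂ) ≠ 0 := fun h => by rw [h] at r1; simp at r1
  have n2 : (x + Complex.I * u : ℂ) ≠ 0 := fun h => by rw [h] at r2; simp at r2
  have n3 : (x ^ 2 + u ^ 2 : ℂ) ≠ 0 := by
    norm_cast
    positivity
  simp only [Complex.ofReal_zero, mul_zero, Complex.exp_zero]
  field_simp
  linear_combination (-2 * (x : ℂ) * u ^ 2) * Complex.I_sq

lemma integrable_exp_neg_abs_mul {x : ℝ} (hx : 0 < x) :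
    Integrable (fun t : ℝ => rexp (-(|t| * x))) := by
  have := (integral_exp_neg_abs_mul hx 0).1.norm
  simpa [Complex.norm_exp] using this

lemma tanh_mul_integral_abs_sin {x : ℝ} (hx : 0 < x) :
    tanh (π * x / 2) * ∫ t : ℝ, rexp (-(|t| * x)) * |sin t| = 2 * (1 + x ^ 2)⁻¹ := by
  have habs : ∫ t : ℝ, rexp (-(|t| * x)) * |sin t| =
      2 * ∫ t in Set.Ioi (0 : ℝ), rexp (-(t * x)) * |sin t| := by
    rw [← integral_comp_abs (f := fun t => rexp (-(t * x)) * |sin t|)]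
    refine integral_congr_ae (ae_of_all _ fun t => ?_)
    rcases abs_choice t with h | h <;> simp [h]
  have hint : IntegrableOn (fun t : ℝ => rexp (-(t * x)) * |sin t|) (Set.Ioi 0) := by
    refine Integrable.mono' (integrable_exp_neg_abs_mul hx).integrableOn
      (by fun_prop) ?_
    filter_upwards [ae_restrict_mem measurableSet_Ioi] with t ht
    rw [norm_mul, norm_of_nonneg (exp_pos _).le, abs_of_pos (Set.mem_Ioi.1 ht),
      Real.norm_eq_abs, abs_abs]
    exact mul_le_of_le_one_right (exp_pos _).le (abs_sin_le_one t)
  have hsplit := intervalIntegral.integral_interval_add_Ioi hint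
    (hint.mono_set (Set.Ioi_subset_Ioi pi_pos.le))
  have hshift : ∫ t in Set.Ioi π, rexp (-(t * x)) * |sin t| =
      rexp (-(π * x)) * ∫ t in Set.Ioi (0 : ℝ), rexp (-(t * x)) * |sin t| := by
    have hmp := (measurePreserving_add_right volume π).setIntegral_preimage_emb
      (measurableEmbedding_addRight π) (fun t => rexp (-(t * x)) * |sin t|) (Set.Ioi π)
    rw [show (fun t : ℝ => t + π) ⁻¹' Set.Ioi π = Set.Ioi 0 by ext; simp] at hmp
    rw [← hmp, ← integral_const_mul]
    refine integral_congr_ae (ae_of_all _ fun t => ?_)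
    simp only [sin_add_pi, abs_neg, ← mul_assoc, ← exp_add]
    ring_nf
  have hbase : ∫ t in (0 : ℝ)..π, rexp (-(t * x)) * |sin t| =
      (1 + rexp (-(π * x))) / (1 + x ^ 2) := by
    have hd (t : ℝ) : HasDerivAt (fun t => -(rexp (-(t * x)) * (x * sin t + cos t)) / (1 + x ^ 2))
        (rexp (-(t * x)) * sin t) t := by
      refine ((((hasDerivAt_id' t).mul_const x).fun_neg.exp.fun_mul
        (((hasDerivAt_sin t).const_mul x).fun_add (hasDerivAt_cos t))).fun_neg.div_const
          (1 + x ^ 2)).congr_deriv ?_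
      have : 1 + x ^ 2 ≠ 0 := by positivity
      field_simp
      ring
    have hc : ∫ t in (0 : ℝ)..π, rexp (-(t * x)) * |sin t| =
        ∫ t in (0 : ℝ)..π, rexp (-(t * x)) * sin t := by
      refine intervalIntegral.integral_congr fun t ht => ?_
      rw [Set.uIcc_of_le pi_pos.le] at ht
      simp only [abs_of_nonneg (sin_nonneg_of_mem_Icc ht)]
    rw [hc, intervalIntegral.integral_eq_sub_of_hasDerivAt (fun t _ => hd t)
      (Continuous.intervalIntegrable (by fun_prop) _ _)]
    simp
    ring
  rw [hbase, hshift] at hsplit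
  have htanh : tanh (π * x / 2) = (1 - rexp (-(π * x))) / (1 + rexp (-(π * x))) := by
    rw [tanh_eq, div_eq_div_iff (by positivity) (by positivity)]
    have e : rexp (-(π * x)) = rexp (-(π * x / 2)) * rexp (-(π * x / 2)) := by
      rw [← exp_add]; ring_nf
    have e' : rexp (π * x / 2) * rexp (-(π * x / 2)) = 1 := by
      rw [← exp_add]; simp
    rw [e]
    linear_combination (2 * rexp (-(π * x / 2))) * e'
  rw [habs, htanh]
  have h1 : (0 : ℝ) < 1 + rexp (-(π * x)) := by positivity
  have h2 : (0 : ℝ) < 1 + x ^ 2 := by positivity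
  field_simp at hsplit ⊢
  linear_combination -hsplit

/-- An integrable kernel of total mass `π / 2` whose Fourier transform is `1 / s` for `1 ≤ |s|`,
written as a double integral over `(x, t) ∈ (0, ∞) × ℝ`. -/
noncomputable def sylvesterKernel (p : ℝ × ℝ) : ℂ :=
  -Complex.I * ((1 / 2 * (tanh (π * p.1 / 2) * (rexp (-(|p.2| * p.1)) * sin p.2)) : ℝ) : ℂ)

lemma continuous_tanh_real : Continuous tanh := by
  simp_rw [funext tanh_eq_sinh_div_cosh]
  exact continuous_sinh.div continuous_cosh fun x => (cosh_pos x).ne'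

lemma continuous_sylvesterKernel : Continuous sylvesterKernel := by
  have := continuous_tanh_real
  unfold sylvesterKernel
  fun_prop

lemma integral_norm_sylvesterKernel {x : ℝ} (hx : 0 < x) :
    ∫ t, ‖sylvesterKernel (x, t)‖ = (1 + x ^ 2)⁻¹ := by
  have hx' : 0 ≤ tanh (π * x / 2) := by
    rw [tanh_eq_sinh_div_cosh]
    exact div_nonneg (sinh_nonneg_iff.2 (by positivity)) (cosh_pos _).le
  have h (t : ℝ) : ‖sylvesterKernel (x, t)‖ =
      1 / 2 * tanh (π * x / 2) * (rexp (-(|t| * x)) * |sin t|) := by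
    simp only [sylvesterKernel, norm_mul, norm_neg, Complex.norm_I, Complex.norm_real, one_mul,
      norm_of_nonneg hx', norm_of_nonneg (exp_pos _).le, Real.norm_eq_abs (sin t)]
    norm_num
    ring
  simp_rw [h]
  rw [integral_const_mul, mul_assoc, tanh_mul_integral_abs_sin hx]
  ring

lemma integrable_sylvesterKernel :
    Integrable sylvesterKernel ((volume.restrict (Set.Ioi 0)).prod volume) := by
  refine (integrable_prod_iff continuous_sylvesterKernel.aestronglyMeasurable).2 ⟨?_, ?_⟩
  · filter_upwards [ae_restrict_mem measurableSet_Ioi] with x hx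
    refine Integrable.mono' ((integrable_exp_neg_abs_mul hx).const_mul
      |1 / 2 * tanh (π * x / 2)|)
      (continuous_sylvesterKernel.comp (Continuous.prodMk_right x)).aestronglyMeasurable
      (ae_of_all _ fun t => ?_)
    simp only [sylvesterKernel]
    rw [norm_mul, norm_neg, Complex.norm_I, one_mul, Complex.norm_real, ← mul_assoc, ← mul_assoc,
      norm_mul, norm_mul, norm_of_nonneg (exp_pos _).le, Real.norm_eq_abs, Real.norm_eq_abs]
    exact mul_le_of_le_one_right (by positivity) (abs_sin_le_one t)
  · refine integrable_inv_one_add_sq.integrableOn.congr ?_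
    filter_upwards [ae_restrict_mem measurableSet_Ioi] with x hx
    exact (integral_norm_sylvesterKernel hx).symm

lemma integral_norm_sylvesterKernel_prod :
    ∫ p, ‖sylvesterKernel p‖ ∂((volume.restrict (Set.Ioi 0)).prod volume) = π / 2 := by
  rw [integral_prod _ integrable_sylvesterKernel.norm,
    setIntegral_congr_fun measurableSet_Ioi fun x hx => integral_norm_sylvesterKernel hx,
    integral_Ioi_inv_one_add_sq, arctan_zero, sub_zero]

lemma integral_sylvesterKernel_mul_exp {x : ℝ} (hx : 0 < x) (s : ℝ) :
    ∫ t : ℝ, sylvesterKernel (x, t) * Complex.exp (Complex.I * t * s) =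
      ((1 / 2 * (tanh (π * x / 2) *
        (x / (x ^ 2 + (s - 1) ^ 2) - x / (x ^ 2 + (s + 1) ^ 2))) : ℝ) : ℂ) := by
  have h (t : ℝ) : sylvesterKernel (x, t) * Complex.exp (Complex.I * t * s) =
      (1 / 4 * tanh (π * x / 2) : ℂ) *
        (Complex.exp (-(|t| * x) + Complex.I * (s - 1 : ℝ) * t) -
          Complex.exp (-(|t| * x) + Complex.I * (s + 1 : ℝ) * t)) := by
    have e1 : Complex.exp (-(|t| * x) + Complex.I * (s - 1 : ℝ) * t) =
        Complex.exp (-(|t| * x)) * Complex.exp (Complex.I * t * s) *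
          Complex.exp (-t * Complex.I) := by
      rw [← Complex.exp_add, ← Complex.exp_add]
      push_cast
      ring_nf
    have e2 : Complex.exp (-(|t| * x) + Complex.I * (s + 1 : ℝ) * t) =
        Complex.exp (-(|t| * x)) * Complex.exp (Complex.I * t * s) *
          Complex.exp (t * Complex.I) := by
      rw [← Complex.exp_add, ← Complex.exp_add]
      push_cast
      ring_nf
    rw [e1, e2]
    simp only [sylvesterKernel]
    push_cast
    rw [Complex.sin]
    linear_combination (-1 / 4 * Complex.tanh (π * x / 2) * Complex.exp (-(|t| * x)) *
      Complex.exp (Complex.I * t * s) *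
      (Complex.exp (-t * Complex.I) - Complex.exp (t * Complex.I))) * Complex.I_sq
  simp_rw [h]
  rw [integral_const_mul, integral_sub (integral_exp_neg_abs_mul hx _).1
    (integral_exp_neg_abs_mul hx _).1, (integral_exp_neg_abs_mul hx _).2,
    (integral_exp_neg_abs_mul hx _).2]
  push_cast
  ring

lemma integral_sylvesterKernel_prod_mul_exp {s : ℝ} (hs : 1 ≤ |s|) :
    ∫ p : ℝ × ℝ, sylvesterKernel p * Complex.exp (Complex.I * p.2 * s)
      ∂((volume.restrict (Set.Ioi 0)).prod volume) = (s : ℂ)⁻¹ := by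
  have hint : Integrable (fun p : ℝ × ℝ =>
      sylvesterKernel p * Complex.exp (Complex.I * p.2 * s))
      ((volume.restrict (Set.Ioi 0)).prod volume) := by
    refine integrable_sylvesterKernel.mul_bdd (c := 1) (by fun_prop) (ae_of_all _ fun p => ?_)
    simp [Complex.norm_exp]
  rw [integral_prod _ hint, setIntegral_congr_fun measurableSet_Ioi
    fun x hx => integral_sylvesterKernel_mul_exp hx s, integral_complex_ofReal,
    integral_const_mul]
  norm_cast
  rcases le_abs.1 hs with h | h
  · rw [integral_tanh_mul h]
    ring
  · have hneg : ∀ x : ℝ, tanh (π * x / 2) *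
        (x / (x ^ 2 + (s - 1) ^ 2) - x / (x ^ 2 + (s + 1) ^ 2)) =
        -(tanh (π * x / 2) *
          (x / (x ^ 2 + (-s - 1) ^ 2) - x / (x ^ 2 + (-s + 1) ^ 2))) := fun x => by
      rw [show (-s - 1) ^ 2 = (s + 1) ^ 2 by ring, show (-s + 1) ^ 2 = (s - 1) ^ 2 by ring]
      ring
    simp_rw [hneg]
    rw [integral_neg, integral_tanh_mul h]
    ring

/-- Sylvester–Rosenblum: for bounded operators `A, B, C` on a complex Hilbert space
with `A, B` selfadjoint and `dist(spect A, spect B) = d > 0`, there is a bounded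
solution `X` of `AX − XB = C` with `‖X‖ ≤ (π/2) ‖C‖ / d`. -/
theorem sylvester_equation_solution
    {H : Type*} [NormedAddCommGroup H] [InnerProductSpace ℂ H] [CompleteSpace H]
    (A B C : H →L[ℂ] H) (hA : IsSelfAdjoint A) (hB : IsSelfAdjoint B)
    (d : ℝ) (hd : 0 < d)
    (hdist : ∀ a ∈ spectrum ℂ A, ∀ b ∈ spectrum ℂ B, d ≤ dist a b) :
    ∃ X : H →L[ℂ] H, A ∘L X - X ∘L B = C ∧ ‖X‖ ≤ π / 2 * ‖C‖ / d := by
  have hdiff : ∀ a ∈ spectrum ℂ A, ∀ b ∈ spectrum ℂ B,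
      ((a.re - b.re : ℝ) : ℂ) = a - b ∧ d ≤ |a.re - b.re| := fun a ha b hb => by
    have e : ((a.re - b.re : ℝ) : ℂ) = a - b := by
      apply Complex.ext <;>
        simp [hA.im_eq_zero_of_mem_spectrum ha, hB.im_eq_zero_of_mem_spectrum hb]
    refine ⟨e, ?_⟩
    rw [← Real.norm_eq_abs, ← Complex.norm_real, e, ← dist_eq_norm]
    exact hdist a ha b hb
  have hne : ∀ a ∈ spectrum ℂ A, ∀ b ∈ spectrum ℂ B, a - b ≠ 0 := fun a ha b hb h => by
    obtain ⟨e, hle⟩ := hdiff a ha b hb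
    rw [← e, Complex.ofReal_eq_zero] at h
    rw [h, abs_zero] at hle
    exact hd.not_ge hle
  have hker : ∀ a ∈ spectrum ℂ A, ∀ b ∈ spectrum ℂ B,
      ∫ p : ℝ × ℝ, (d : ℂ)⁻¹ * sylvesterKernel p *
        Complex.exp (Complex.I * ((p.2 / d : ℝ) : ℂ) * (a - b))
          ∂((volume.restrict (Set.Ioi 0)).prod volume) = (a - b)⁻¹ := fun a ha b hb => by
    obtain ⟨e, hle⟩ := hdiff a ha b hb
    have hs : 1 ≤ |(a.re - b.re) / d| := by
      rw [abs_div, abs_of_pos hd]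
      exact (one_le_div hd).2 hle
    have hd' : (d : ℂ) ≠ 0 := by exact_mod_cast hd.ne'
    have hexp : ∀ p : ℝ × ℝ, Complex.I * ((p.2 / d : ℝ) : ℂ) * ((a.re - b.re : ℝ) : ℂ) =
        Complex.I * p.2 * (((a.re - b.re) / d : ℝ) : ℂ) := fun p => by
      push_cast
      ring
    rw [← e]
    simp_rw [mul_assoc ((d : ℂ)⁻¹), hexp]
    rw [integral_const_mul, integral_sylvesterKernel_prod_mul_exp hs]
    push_cast
    field_simp
  obtain ⟨X, hX, hle⟩ := exists_sylvester_of_kernel C hA hB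
    (integrable_sylvesterKernel.const_mul ((d : ℂ)⁻¹)) (measurable_snd.div_const d) hne hker
  refine ⟨X, hX, hle.trans_eq ?_⟩
  simp_rw [norm_mul]
  rw [integral_const_mul, integral_norm_sylvesterKernel_prod, norm_inv, Complex.norm_real,
    norm_of_nonneg hd.le]
  ring
end

section
/- For the Laguerre generating-type coefficient B₀^{n,m,l} defined by the expansion L_n^l(x/2) L_m^l(x/2) = ∑_{s≥0} B_s^{n,m,l} L_s^l(x), it holds B₀^{n,m,l} = (1/2^{m+n}) · (l+m+n)!/(l! m! n!) for nonnegative integers l, m, n. -/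
open Real Finset

/-- The associated Laguerre polynomial `L_n^l(x) = ∑_{j=0}^n ((−x)^j/j!) C(n+l, n−j)`. -/
noncomputable def laguerre (n l : ℕ) (x : ℝ) : ℝ :=
  ∑ j ∈ Finset.range (n + 1), (-x) ^ j / j.factorial * ((n + l).choose (n - j))

open Polynomial in
/-- The polynomial `L_n^l(c x)` in the variable `x`. -/
noncomputable def scaledLaguerrePoly (c : ℝ) (n l : ℕ) : ℝ[X] :=
  ∑ j ∈ Finset.range (n + 1),
    monomial j ((-c) ^ j / j.factorial * ((n + l).choose (l + j)))

lemma eval_scaledLaguerrePoly (c : ℝ) (n l : ℕ) (x : ℝ) :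
    (scaledLaguerrePoly c n l).eval x = laguerre n l (c * x) := by
  unfold scaledLaguerrePoly laguerre
  rw [Polynomial.eval_finsetSum]
  refine Finset.sum_congr rfl fun j hj => ?_
  have hj' : j ≤ n := Nat.lt_succ_iff.1 (Finset.mem_range.1 hj)
  rw [Polynomial.eval_monomial, Nat.choose_symm_of_eq_add (by omega : n + l = (l + j) + (n - j)),
    ← neg_mul, mul_pow]
  ring

/-- The functional `p ↦ ∫₀^∞ p(x) x^l e^{-x} dx` on polynomials, given by its moments. -/
noncomputable def gammaMoment (l : ℕ) : Polynomial ℝ →ₗ[ℝ] ℝ :=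
  Polynomial.lsum fun k => LinearMap.mulRight ℝ ((l + k).factorial : ℝ)

lemma gammaMoment_monomial (l k : ℕ) (a : ℝ) :
    gammaMoment l (Polynomial.monomial k a) = a * (l + k).factorial := by
  simp [gammaMoment, Polynomial.lsum_apply, Polynomial.sum_monomial_index]

lemma sum_choose_mul_choose_mul_pow (n l i : ℕ) (r : ℝ) :
    ∑ j ∈ Finset.range (n + 1), ((n + l).choose (l + j) : ℝ) * (l + j).choose (l + i) * r ^ j =
      (n + l).choose (l + i) * r ^ i * (r + 1) ^ (n - i) := by
  rcases lt_or_ge n i with h | h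
  · rw [Nat.choose_eq_zero_of_lt (by omega : n + l < l + i)]
    simp only [Nat.cast_zero, zero_mul]
    refine Finset.sum_eq_zero fun j hj => ?_
    have := Finset.mem_range.1 hj
    rw [Nat.choose_eq_zero_of_lt (by omega : l + j < l + i)]
    simp
  · obtain ⟨d, rfl⟩ := Nat.exists_eq_add_of_le h
    rw [add_assoc i d 1, Finset.sum_range_add, Finset.sum_eq_zero, zero_add,
      Nat.add_sub_cancel_left, add_pow, Finset.mul_sum]
    · refine Finset.sum_congr rfl fun j hj => ?_
      have hj' := Finset.mem_range.1 hj
      have h := Nat.choose_mul (n := i + d + l) (k := l + (i + j)) (s := l + i)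
        (by omega)
      rw [(by omega : i + d + l - (l + i) = d), (by omega : l + (i + j) - (l + i) = j)] at h
      have h' : ((i + d + l).choose (l + (i + j)) : ℝ) * (l + (i + j)).choose (l + i) =
        (i + d + l).choose (l + i) * d.choose j := by exact_mod_cast h
      rw [h', one_pow, pow_add]
      ring
    · intro j hj
      have := Finset.mem_range.1 hj
      rw [Nat.choose_eq_zero_of_lt (by omega : l + j < l + i)]
      simp

lemma sum_factorial_div_mul_choose_mul_choose (l j k N : ℕ) (hN : j < N) :
    ∑ i ∈ Finset.range N, ((l + i).factorial : ℝ) / i.factorial *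
      (l + k).choose (l + i) * (l + j).choose (l + i) =
      (l + j + k).factorial / (j.factorial * k.factorial) := by
  rw [← Finset.sum_subset (Finset.range_mono (Nat.succ_le_of_lt hN))]
  · have hV := Nat.add_choose_eq k (l + j) j
    rw [Finset.Nat.sum_antidiagonal_eq_sum_range_succ
      (fun a b => k.choose a * (l + j).choose b)] at hV
    have hV' : ((k + (l + j)).choose j : ℝ) =
      ∑ i ∈ Finset.range (j + 1), (k.choose i : ℝ) * (l + j).choose (j - i) := by
      exact_mod_cast hV
    have hC : ((k + (l + j)).choose j : ℝ) =
        (l + j + k).factorial / (j.factorial * (l + k).factorial) := by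
      rw [Nat.cast_choose ℝ (by omega), (by omega : k + (l + j) - j = l + k),
        (by omega : k + (l + j) = l + j + k)]
    have key : ((l + j + k).factorial : ℝ) / (j.factorial * k.factorial) =
        (l + k).factorial / k.factorial * (k + (l + j)).choose j := by
      rw [hC]
      field_simp
    rw [key, hV', Finset.mul_sum]
    refine Finset.sum_congr rfl fun i hi => ?_
    have hi' := Finset.mem_range.1 hi
    rw [Nat.choose_symm_of_eq_add (by omega : l + j = (l + i) + (j - i)), ← mul_assoc]
    congr 1
    rcases lt_or_ge k i with h | h
    · rw [Nat.choose_eq_zero_of_lt h, Nat.choose_eq_zero_of_lt (by omega : l + k < l + i)]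
      simp
    · rw [Nat.cast_choose ℝ h, Nat.cast_choose ℝ (by omega : l + i ≤ l + k),
        (by omega : l + k - (l + i) = k - i)]
      field_simp
  · intro i _ hi
    have : j < i := by simpa using hi
    rw [Nat.choose_eq_zero_of_lt (by omega : l + j < l + i)]
    simp

lemma gammaMoment_scaledLaguerrePoly_one (s l : ℕ) :
    gammaMoment l (scaledLaguerrePoly 1 s l) = if s = 0 then (l.factorial : ℝ) else 0 := by
  have h := sum_choose_mul_choose_mul_pow s l 0 (-1)
  have : gammaMoment l (scaledLaguerrePoly 1 s l) = l.factorial *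
      ∑ j ∈ Finset.range (s + 1),
        ((s + l).choose (l + j) : ℝ) * (l + j).choose (l + 0) * (-1) ^ j := by
    simp only [scaledLaguerrePoly, map_sum, gammaMoment_monomial, Finset.mul_sum]
    refine Finset.sum_congr rfl fun j _ => ?_
    rw [add_zero, Nat.cast_add_choose ℝ]
    field_simp
  rw [this, h]
  rcases eq_or_ne s 0 with rfl | hs
  · simp
  · simp [hs]

lemma gammaMoment_scaledLaguerrePoly_half_mul (n m l : ℕ) :
    gammaMoment l (scaledLaguerrePoly (1 / 2) n l * scaledLaguerrePoly (1 / 2) m l) =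
      1 / 2 ^ (m + n) * ((l + m + n).factorial / (m.factorial * n.factorial)) := by
  calc
    _ = ∑ j ∈ Finset.range (n + 1), ∑ k ∈ Finset.range (m + 1), ∑ i ∈ Finset.range (n + 1),
        ((l + i).factorial : ℝ) / i.factorial *
          ((n + l).choose (l + j) * (l + j).choose (l + i) * (-(1 / 2)) ^ j) *
          ((m + l).choose (l + k) * (l + k).choose (l + i) * (-(1 / 2)) ^ k) := by
      simp only [scaledLaguerrePoly, Finset.sum_mul_sum, map_sum, Polynomial.monomial_mul_monomial,
        gammaMoment_monomial]
      refine Finset.sum_congr rfl fun j hj => Finset.sum_congr rfl fun k _ => ?_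
      have h := sum_factorial_div_mul_choose_mul_choose l j k (n + 1) (Finset.mem_range.1 hj)
      calc
        _ = (-(1 / 2)) ^ j * (-(1 / 2)) ^ k * (n + l).choose (l + j) * (m + l).choose (l + k) *
            ((l + j + k).factorial / (j.factorial * k.factorial) : ℝ) := by
          rw [← add_assoc]
          field_simp
        _ = _ := by
          rw [← h, Finset.mul_sum]
          exact Finset.sum_congr rfl fun i _ => by ring
    _ = ∑ i ∈ Finset.range (n + 1), ((l + i).factorial : ℝ) / i.factorial *
          ((n + l).choose (l + i) * (-(1 / 2)) ^ i * (-(1 / 2) + 1) ^ (n - i)) *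
          ((m + l).choose (l + i) * (-(1 / 2)) ^ i * (-(1 / 2) + 1) ^ (m - i)) := by
      simp_rw [← sum_choose_mul_choose_mul_pow, mul_assoc _ (Finset.sum _ _) (Finset.sum _ _),
        Finset.sum_mul_sum, Finset.mul_sum, ← mul_assoc]
      simp_rw [Finset.sum_comm (s := Finset.range (m + 1)) (t := Finset.range (n + 1))]
      exact Finset.sum_comm
    _ = 1 / 2 ^ (m + n) * ∑ i ∈ Finset.range (n + 1), ((l + i).factorial : ℝ) / i.factorial *
          (l + m).choose (l + i) * (l + n).choose (l + i) := by
      rw [Finset.mul_sum]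
      refine Finset.sum_congr rfl fun i hi => ?_
      have hi' := Finset.mem_range.1 hi
      rw [add_comm n l, add_comm m l]
      rcases lt_or_ge m i with h | h
      · rw [Nat.choose_eq_zero_of_lt (by omega : l + m < l + i)]
        simp
      · obtain ⟨a, rfl⟩ := Nat.exists_eq_add_of_le h
        obtain ⟨b, rfl⟩ := Nat.exists_eq_add_of_le (Nat.lt_succ_iff.1 hi')
        have hs : ((-(1 / 2)) ^ i * (-(1 / 2)) ^ i : ℝ) = (1 / 2) ^ i * (1 / 2) ^ i := by
          rw [← mul_pow, ← mul_pow]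
          norm_num
        rw [Nat.add_sub_cancel_left, Nat.add_sub_cancel_left,
          (by norm_num : (-(1 / 2) + 1 : ℝ) = 1 / 2), ← one_div_pow, pow_add, pow_add, pow_add]
        linear_combination ((l + i).factorial : ℝ) / i.factorial *
          (l + (i + b)).choose (l + i) * (l + (i + a)).choose (l + i) *
          (1 / 2) ^ a * (1 / 2) ^ b * hs
    _ = _ := by
      rw [sum_factorial_div_mul_choose_mul_choose l n m (n + 1) (Nat.lt_succ_self n),
        add_right_comm l n m, mul_comm (n.factorial : ℝ)]

/-- If `B` are the coefficients of the expansion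
`L_n^l(x/2) L_m^l(x/2) = ∑_s B_s L_s^l(x)` (a finite sum, `s ≤ n+m`), then
`B₀ = (1/2^{m+n}) (l+m+n)!/(l! m! n!)`. -/
theorem laguerre_product_constant_coeff (n m l : ℕ) (B : ℕ → ℝ)
    (hB : ∀ x : ℝ, laguerre n l (x / 2) * laguerre m l (x / 2) =
      ∑ s ∈ Finset.range (n + m + 1), B s * laguerre s l x) :
    B 0 = 1 / 2 ^ (m + n) *
      ((l + m + n).factorial : ℝ) / (l.factorial * m.factorial * n.factorial) := by
  have hP : scaledLaguerrePoly (1 / 2) n l * scaledLaguerrePoly (1 / 2) m l =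
      ∑ s ∈ Finset.range (n + m + 1), B s • scaledLaguerrePoly 1 s l := by
    refine Polynomial.funext fun x => ?_
    simp only [Polynomial.eval_mul, Polynomial.eval_finsetSum, Polynomial.eval_smul,
      eval_scaledLaguerrePoly, smul_eq_mul, one_mul]
    rw [← hB x, one_div_mul_eq_div]
  have h := congrArg (gammaMoment l) hP
  simp only [gammaMoment_scaledLaguerrePoly_half_mul, map_sum, map_smul, smul_eq_mul,
    gammaMoment_scaledLaguerrePoly_one, mul_ite, mul_zero, Finset.sum_ite_eq',
    Finset.mem_range, Nat.succ_pos, if_true] at h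
  have hl : (l.factorial : ℝ) ≠ 0 := by positivity
  rw [mul_assoc (l.factorial : ℝ), mul_comm (l.factorial : ℝ), ← div_div, mul_div_assoc, h,
    mul_div_cancel_right₀ _ hl]
end

section
/- For nonnegative integers l, m, n, it holds ∫₀^∞ L_n^l(x/2) L_m^l(x/2) x^l e^{−x} dx = (1/2^{m+n}) · (l+m+n)!/(m! n!). -/
open Real MeasureTheory

open Finset in
theorem factorial_add_add_eq_sum {l i j n : ℕ} (hi : i ≤ n) :
    ((l + i + j).factorial : ℝ) = (l + i).factorial * (l + j).factorial *
      ∑ k ∈ range (n + 1), (i.choose k : ℝ) * j.choose k * (k.factorial / (l + k).factorial) := by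
  have hvan : (((l + i + j).choose i : ℕ) : ℝ) =
      ∑ k ∈ range (i + 1), (j.choose k : ℝ) * (l + i).choose (i - k) := by
    rw [add_comm (l + i) j, Nat.add_choose_eq, Finset.Nat.sum_antidiagonal_eq_sum_range_succ_mk]
    push_cast
    rfl
  have hfac : ((l + i + j).factorial : ℝ) =
      (l + i + j).choose i * i.factorial * (l + j).factorial := by
    have h := Nat.choose_mul_factorial_mul_factorial (show i ≤ l + i + j by omega)
    rw [show l + i + j - i = l + j by omega] at h
    exact_mod_cast h.symm
  rw [← sum_subset (range_subset_range.2 (Nat.succ_le_succ hi)), hfac, hvan, sum_mul, sum_mul,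
    mul_sum]
  · refine sum_congr rfl fun k hk => ?_
    have hk : k ≤ i := by simpa [Nat.lt_succ_iff] using hk
    rw [Nat.cast_choose ℝ hk, Nat.cast_choose ℝ (show i - k ≤ l + i by omega),
      show l + i - (i - k) = l + k by omega]
    field_simp
  · intro k _ hk
    have hk : i < k := by simpa [Nat.lt_succ_iff] using hk
    simp [Nat.choose_eq_zero_of_lt hk]

open Finset in
theorem sum_pow_mul_choose_mul_choose (x : ℝ) (n k : ℕ) :
    ∑ i ∈ range (n + 1), x ^ i * (n.choose i : ℝ) * i.choose k =
      n.choose k * x ^ k * (1 + x) ^ (n - k) := by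
  rcases lt_or_ge n k with h | h
  · rw [Nat.choose_eq_zero_of_lt h]
    simp only [Nat.cast_zero, zero_mul]
    refine sum_eq_zero fun i hi => ?_
    rw [Nat.choose_eq_zero_of_lt (show i < k by have := mem_range.1 hi; omega)]
    simp
  · obtain ⟨d, rfl⟩ := Nat.exists_eq_add_of_le h
    rw [add_assoc, sum_range_add, sum_eq_zero, zero_add, Nat.add_sub_cancel_left, add_comm 1 x,
      add_pow, mul_sum]
    · refine sum_congr rfl fun t ht => ?_
      have hc : ((k + d).choose (k + t) : ℝ) * (k + t).choose k =
          (k + d).choose k * d.choose t := by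
        have h := Nat.choose_mul (n := k + d) (k := k + t) (s := k) (by omega)
        rw [Nat.add_sub_cancel_left, Nat.add_sub_cancel_left] at h
        exact_mod_cast h
      rw [mul_assoc, hc]
      ring
    · intro i hi
      rw [Nat.choose_eq_zero_of_lt (mem_range.1 hi)]
      simp

/-- The coefficient of `x ^ i` in `laguerre n l (x / 2)`. -/
noncomputable def halfLaguerreCoeff (n l i : ℕ) : ℝ :=
  (-1 / 2) ^ i / i.factorial * ((n + l).choose (n - i))

theorem laguerre_half (n l : ℕ) (x : ℝ) :
    laguerre n l (x / 2) = ∑ i ∈ Finset.range (n + 1), halfLaguerreCoeff n l i * x ^ i := by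
  refine Finset.sum_congr rfl fun i _ => ?_
  rw [halfLaguerreCoeff, show -(x / 2) = -1 / 2 * x by ring, mul_pow]
  ring

open Finset in
theorem sum_halfLaguerreCoeff_mul_choose (n l k : ℕ) :
    ∑ i ∈ range (n + 1), halfLaguerreCoeff n l i * (l + i).factorial * i.choose k =
      (l + n).factorial / n.factorial * n.choose k * (-1) ^ k / 2 ^ n := by
  have hterm : ∀ i ∈ range (n + 1), halfLaguerreCoeff n l i * (l + i).factorial * i.choose k =
      (l + n).factorial / n.factorial * ((-1 / 2) ^ i * (n.choose i : ℝ) * i.choose k) := by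
    intro i hi
    have hi : i ≤ n := by simpa [Nat.lt_succ_iff] using hi
    rw [halfLaguerreCoeff, Nat.cast_choose ℝ hi, Nat.cast_choose ℝ (show n - i ≤ n + l by omega),
      show n + l - (n - i) = l + i by omega, add_comm n l]
    field_simp
  rw [sum_congr rfl hterm, ← mul_sum, sum_pow_mul_choose_mul_choose]
  rcases lt_or_ge n k with h | h
  · simp [Nat.choose_eq_zero_of_lt h]
  · obtain ⟨d, rfl⟩ := Nat.exists_eq_add_of_le h
    rw [Nat.add_sub_cancel_left, show (1 + -1 / 2 : ℝ) = 1 / 2 by norm_num, div_pow, div_pow,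
      pow_add]
    field_simp
    simp

open Finset in
theorem sum_halfLaguerreCoeff_mul_factorial (n m l : ℕ) :
    ∑ i ∈ range (n + 1), ∑ j ∈ range (m + 1),
        halfLaguerreCoeff n l i * halfLaguerreCoeff m l j * (l + i + j).factorial =
      1 / 2 ^ (m + n) * ((l + m + n).factorial : ℝ) / (m.factorial * n.factorial) := by
  calc
    _ = ∑ i ∈ range (n + 1), ∑ j ∈ range (m + 1), ∑ k ∈ range (n + 1),
        (k.factorial / (l + k).factorial : ℝ) *
          ((halfLaguerreCoeff n l i * (l + i).factorial * i.choose k) *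
            (halfLaguerreCoeff m l j * (l + j).factorial * j.choose k)) := by
      refine sum_congr rfl fun i hi => sum_congr rfl fun j _ => ?_
      rw [factorial_add_add_eq_sum (show i ≤ n by simpa [Nat.lt_succ_iff] using hi), mul_sum,
        mul_sum]
      exact sum_congr rfl fun k _ => by ring
    _ = ∑ k ∈ range (n + 1), (k.factorial / (l + k).factorial : ℝ) *
          ((∑ i ∈ range (n + 1), halfLaguerreCoeff n l i * (l + i).factorial * i.choose k) *
            ∑ j ∈ range (m + 1), halfLaguerreCoeff m l j * (l + j).factorial * j.choose k) := by
      simp_rw [sum_mul_sum, mul_sum]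
      rw [sum_comm (s := range (n + 1)) (t := range (n + 1))]
      exact sum_congr rfl fun i _ => sum_comm
    _ = _ := by
      simp_rw [sum_halfLaguerreCoeff_mul_choose]
      rw [show l + m + n = l + n + m by ring, factorial_add_add_eq_sum le_rfl, mul_sum, mul_sum,
        sum_div]
      refine sum_congr rfl fun k _ => ?_
      have hsign : ((-1 : ℝ) ^ k) * (-1) ^ k = 1 := by rw [← mul_pow]; simp
      rw [pow_add]
      field_simp
      linear_combination (n.choose k * m.choose k : ℝ) * hsign

theorem integrableOn_pow_mul_exp_neg (k : ℕ) :
    IntegrableOn (fun x : ℝ => x ^ k * Real.exp (-x)) (Set.Ioi 0) := by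
  refine (Real.GammaIntegral_convergent (s := k + 1) (by positivity)).congr_fun (fun x _ => ?_)
    measurableSet_Ioi
  simp [mul_comm]

theorem integral_pow_mul_exp_neg (k : ℕ) :
    ∫ x in Set.Ioi (0 : ℝ), x ^ k * Real.exp (-x) = k.factorial := by
  rw [← Real.Gamma_nat_eq_factorial, Real.Gamma_eq_integral (by positivity)]
  simp [mul_comm]

/-- `∫₀^∞ L_n^l(x/2) L_m^l(x/2) x^l e^{−x} dx = (1/2^{m+n}) (l+m+n)!/(m! n!)`. -/
theorem laguerre_product_integral (n m l : ℕ) :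
    ∫ x in Set.Ioi (0 : ℝ),
        laguerre n l (x / 2) * laguerre m l (x / 2) * x ^ l * Real.exp (-x) =
      1 / 2 ^ (m + n) * ((l + m + n).factorial : ℝ) / (m.factorial * n.factorial) := by
  have hexpand : ∀ x : ℝ,
      laguerre n l (x / 2) * laguerre m l (x / 2) * x ^ l * Real.exp (-x) =
        ∑ i ∈ Finset.range (n + 1), ∑ j ∈ Finset.range (m + 1),
          halfLaguerreCoeff n l i * halfLaguerreCoeff m l j *
            (x ^ (l + i + j) * Real.exp (-x)) := by
    intro x
    rw [laguerre_half, laguerre_half, Finset.sum_mul_sum]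
    simp_rw [Finset.sum_mul]
    exact Finset.sum_congr rfl fun i _ => Finset.sum_congr rfl fun j _ => by ring
  have hintegrable : ∀ i j : ℕ, IntegrableOn (fun x : ℝ => halfLaguerreCoeff n l i *
      halfLaguerreCoeff m l j * (x ^ (l + i + j) * Real.exp (-x))) (Set.Ioi 0) :=
    fun i j => (integrableOn_pow_mul_exp_neg (l + i + j)).const_mul _
  simp_rw [hexpand]
  rw [integral_finsetSum _ fun i _ => integrable_finsetSum _ fun j _ => hintegrable i j,
    ← sum_halfLaguerreCoeff_mul_factorial]
  refine Finset.sum_congr rfl fun i _ => ?_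
  rw [integral_finsetSum _ fun j _ => hintegrable i j]
  exact Finset.sum_congr rfl fun j _ => by rw [integral_const_mul, integral_pow_mul_exp_neg]
end
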